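/- arXiv:1801.06749 — 3 statements merged into one kernel-verified Lean document; each statement's English description precedes it below -/
import Mathlib

section
/- Let ν be a Borel probability measure on [0,∞) with ∫₀^∞ s dν(s) = 1 and g''(0) := ∫₀^∞ s² dν(s) < ∞, and let g(z) = ∫₀^∞ e^{−zs} dν(s). Then for every t ≥ 0 and every positive integer n: 0 ≤ g(t/n)ⁿ − e^{−t} ≤ (g''(0) − 1) t² / (2n). -/
open MeasureTheory Real Set Filter

theorem exp_neg_le_quadratic {h : ℝ} (hh : 0 ≤ h) : exp (-h) ≤ 1 - h + h ^ 2 / 2 := by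
  have hd : ∀ x : ℝ, HasDerivAt (fun x : ℝ => 1 - x + x ^ 2 / 2 - exp (-x))
      (-1 + x + exp (-x)) x := by
    intro x
    refine ((((hasDerivAt_id' x).const_sub 1).add (((hasDerivAt_id' x).pow 2).div_const 2)).sub
      (hasDerivAt_id' x).fun_neg.exp).congr_deriv ?_
    simp
  have hm : MonotoneOn (fun x : ℝ => 1 - x + x ^ 2 / 2 - exp (-x)) (Ici 0) :=
    monotoneOn_of_hasDerivWithinAt_nonneg (convex_Ici 0)
      (fun x _ => (hd x).continuousAt.continuousWithinAt)
      (fun x _ => (hd x).hasDerivWithinAt)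
      (fun x _ => by linarith [add_one_le_exp (-x)])
  have := hm self_mem_Ici hh hh
  norm_num at this
  linarith

theorem one_sub_sq_div_two_le_one_add_mul_exp_neg {k : ℝ} (hk : 0 ≤ k) :
    1 - k ^ 2 / 2 ≤ (1 + k) * exp (-k) := by
  have hd : ∀ x : ℝ, HasDerivAt (fun x : ℝ => (1 + x) * exp (-x) + x ^ 2 / 2)
      (x * (1 - exp (-x))) x := by
    intro x
    refine ((((hasDerivAt_id' x).const_add 1).mul (hasDerivAt_id' x).fun_neg.exp).add
      (((hasDerivAt_id' x).pow 2).div_const 2)).congr_deriv ?_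
    simp
    ring
  have hm : MonotoneOn (fun x : ℝ => (1 + x) * exp (-x) + x ^ 2 / 2) (Ici 0) :=
    monotoneOn_of_hasDerivWithinAt_nonneg (convex_Ici 0)
      (fun x _ => (hd x).continuousAt.continuousWithinAt)
      (fun x _ => (hd x).hasDerivWithinAt)
      (fun x hx => by
        rw [interior_Ici] at hx
        have hx' : 0 < x := hx
        exact mul_nonneg hx'.le (sub_nonneg.2 (exp_le_one_iff.2 (by linarith))))
  have := hm self_mem_Ici hk hk
  norm_num at this
  linarith

/-- Taylor's upper bound for `exp (-u)` around `v` on the half-line. -/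
theorem exp_neg_le_taylor {u v : ℝ} (hu : 0 ≤ u) (hv : 0 ≤ v) :
    exp (-u) ≤ exp (-v) * (1 - (u - v)) + (u - v) ^ 2 / 2 := by
  rcases le_total v u with h | h
  · have h1 := exp_neg_le_quadratic (sub_nonneg.2 h)
    have h2 : exp (-u) = exp (-v) * exp (-(u - v)) := by rw [← exp_add]; ring_nf
    have h3 : exp (-v) ≤ 1 := exp_le_one_iff.2 (by linarith)
    rw [h2]
    nlinarith [mul_le_mul_of_nonneg_left h1 (exp_pos (-v)).le,
      mul_le_mul_of_nonneg_right h3 (sq_nonneg (u - v))]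
  · have h1 := one_sub_sq_div_two_le_one_add_mul_exp_neg (sub_nonneg.2 h)
    have h2 : exp (-v) = exp (-u) * exp (-(v - u)) := by rw [← exp_add]; ring_nf
    have h3 : exp (-u) ≤ 1 := exp_le_one_iff.2 (by linarith)
    rw [h2]
    nlinarith [mul_le_mul_of_nonneg_left h1 (exp_pos (-u)).le,
      mul_le_mul_of_nonneg_right h3 (sq_nonneg (u - v))]

theorem exp_neg_tangent_le (u v : ℝ) : exp (-v) * (1 - (u - v)) ≤ exp (-u) := by
  have h2 : exp (-u) = exp (-v) * exp (-(u - v)) := by rw [← exp_add]; ring_nf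
  rw [h2]
  exact mul_le_mul_of_nonneg_left (by linarith [add_one_le_exp (-(u - v))]) (exp_pos _).le

theorem integral_exp_neg_mul_bounds (ν : Measure ℝ) [IsProbabilityMeasure ν]
    (hpos : ∀ᵐ s ∂ν, 0 ≤ s) (hint : Integrable (fun s => s) ν) (hmean : (∫ s, s ∂ν) = 1)
    (hm2 : Integrable (fun s => s ^ 2) ν) {z : ℝ} (hz : 0 ≤ z) :
    exp (-z) ≤ ∫ s, exp (-z * s) ∂ν ∧ (∫ s, exp (-z * s) ∂ν) ≤ 1 ∧
      (∫ s, exp (-z * s) ∂ν) - exp (-z) ≤ ((∫ s, s ^ 2 ∂ν) - 1) * z ^ 2 / 2 := by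
  have hle : ∀ᵐ s ∂ν, exp (-z * s) ≤ 1 := by
    filter_upwards [hpos] with s hs
    exact exp_le_one_iff.2 (by nlinarith [mul_nonneg hz hs])
  have hexp : Integrable (fun s => exp (-z * s)) ν := by
    refine (integrable_const (1 : ℝ)).mono' (by fun_prop) ?_
    filter_upwards [hle] with s hs
    rwa [norm_of_nonneg (exp_pos _).le]
  have hlin : Integrable (fun s => exp (-z) * (1 + z) - exp (-z) * z * s) ν :=
    (integrable_const _).sub (hint.const_mul _)
  have hlinint : ∫ s, (exp (-z) * (1 + z) - exp (-z) * z * s) ∂ν = exp (-z) := by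
    rw [integral_sub (integrable_const _) (hint.const_mul _),
      integral_const_mul (exp (-z) * z), hmean]
    simp
    ring
  have hsub : Integrable (fun s => s ^ 2 - 2 * s) ν := hm2.sub (hint.const_mul 2)
  have hquad : Integrable (fun s => z ^ 2 / 2 * (s ^ 2 - 2 * s + 1)) ν :=
    (hsub.add (integrable_const 1)).const_mul _
  have hquadint : ∫ s, z ^ 2 / 2 * (s ^ 2 - 2 * s + 1) ∂ν
      = ((∫ s, s ^ 2 ∂ν) - 1) * z ^ 2 / 2 := by
    rw [integral_const_mul, integral_add hsub (integrable_const 1),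
      integral_sub hm2 (hint.const_mul 2), integral_const_mul, hmean]
    simp
    ring
  refine ⟨?_, ?_, ?_⟩
  · rw [← hlinint]
    refine integral_mono hlin hexp fun s => ?_
    have := exp_neg_tangent_le (z * s) z
    rw [← neg_mul] at this
    dsimp only
    linarith
  · simpa using integral_mono_ae hexp (integrable_const (1 : ℝ)) hle
  · rw [sub_le_iff_le_add, ← hquadint]
    nth_rewrite 1 [← hlinint]
    rw [← integral_add hquad hlin]
    refine integral_mono_ae hexp (hquad.add hlin) ?_
    filter_upwards [hpos] with s hs
    have := exp_neg_le_taylor (mul_nonneg hz hs) hz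
    rw [← neg_mul] at this
    linarith

theorem pow_sub_pow_le_mul_sub {a b : ℝ} (hb : 0 ≤ b) (hab : b ≤ a) (ha : a ≤ 1) (n : ℕ) :
    a ^ n - b ^ n ≤ n * (a - b) := by
  induction n with
  | zero => simp
  | succ n ih =>
    have ha0 : 0 ≤ a := hb.trans hab
    have h1 : b ^ n ≤ 1 := pow_le_one₀ hb (hab.trans ha)
    have h2 : b ^ n ≤ a ^ n := pow_le_pow_left₀ hb hab n
    push_cast
    rw [pow_succ, pow_succ]
    nlinarith [mul_nonneg (sub_nonneg.2 h2) (sub_nonneg.2 ha),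
      mul_nonneg (sub_nonneg.2 h1) (sub_nonneg.2 hab)]

theorem stmt_4
    (ν : Measure ℝ) [IsProbabilityMeasure ν]
    (hsupp : ν (Set.Iio 0) = 0)
    (hint : Integrable (fun s => s) ν)
    (hmean : (∫ s, s ∂ν) = 1)
    (hm2 : Integrable (fun s => s ^ 2) ν)
    (g : ℝ → ℝ) (hg : ∀ z : ℝ, g z = ∫ s, Real.exp (-z * s) ∂ν) :
    ∀ t : ℝ, 0 ≤ t → ∀ n : ℕ, 0 < n →
      0 ≤ g (t / n) ^ n - Real.exp (-t) ∧
      g (t / n) ^ n - Real.exp (-t) ≤ ((∫ s, s ^ 2 ∂ν) - 1) * t ^ 2 / (2 * n) := by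
  intro t ht n hn
  have hn' : (0 : ℝ) < n := Nat.cast_pos.2 hn
  have hpos : ∀ᵐ s ∂ν, 0 ≤ s := by
    rw [ae_iff]
    simp only [not_le]
    exact hsupp
  obtain ⟨h1, h2, h3⟩ :=
    integral_exp_neg_mul_bounds ν hpos hint hmean hm2 (div_nonneg ht hn'.le)
  rw [← hg] at h1 h2 h3
  have hexp : exp (-t) = exp (-(t / n)) ^ n := by
    rw [← exp_nat_mul]
    congr 1
    field_simp
  rw [hexp]
  refine ⟨sub_nonneg.2 (pow_le_pow_left₀ (exp_pos _).le h1 n), ?_⟩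
  calc g (t / n) ^ n - exp (-(t / n)) ^ n
      ≤ n * (g (t / n) - exp (-(t / n))) := pow_sub_pow_le_mul_sub (exp_pos _).le h1 h2 n
    _ ≤ n * (((∫ s, s ^ 2 ∂ν) - 1) * (t / n) ^ 2 / 2) := mul_le_mul_of_nonneg_left h3 hn'.le
    _ = ((∫ s, s ^ 2 ∂ν) - 1) * t ^ 2 / (2 * n) := by
      field_simp
end

section
/- Let ν be a Borel probability measure on [0,∞) with ∫₀^∞ s dν(s) = 1, g(z) = ∫₀^∞ e^{−zs} dν(s), and g'(z) = −∫₀^∞ s e^{−zs} dν(s). Then (noting that 0 < 1 − g(1)) one has L[g] ≤ ( (1 + g'(1)) ∫₀¹ g(s) ds / (1 − g(1))² − 1 )^{1/2} + 2e ∫₀¹ (g(s) + g'(s)) ds, where L[g] := ∫_{[0,1]} (1−s) dν(s) and the expression under the square root is nonnegative. -/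
open MeasureTheory Real Set Filter

/-- The weight `w(s) = ∫₀¹ e^{-zs} dz`, equal to `(1 - e^{-s}) / s` for `s ≠ 0`. -/
noncomputable def expWeight (s : ℝ) : ℝ := ∫ z in (0:ℝ)..1, Real.exp (-z * s)

lemma intervalIntegrable_exp_neg_mul (s a b : ℝ) :
    IntervalIntegrable (fun z => Real.exp (-z * s)) volume a b :=
  (by fun_prop : Continuous fun z => Real.exp (-z * s)).intervalIntegrable a b

lemma mul_expWeight (s : ℝ) : s * expWeight s = 1 - Real.exp (-s) := by
  have h : ∀ z ∈ Set.uIcc (0:ℝ) 1,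
      HasDerivAt (fun z => -Real.exp (-z * s)) (s * Real.exp (-z * s)) z := by
    intro z _
    have h1 : HasDerivAt (fun z : ℝ => -z * s) (-1 * s) z := (hasDerivAt_neg z).mul_const s
    exact h1.exp.neg.congr_deriv (by ring)
  have := intervalIntegral.integral_eq_sub_of_hasDerivAt h
    ((intervalIntegrable_exp_neg_mul s 0 1).const_mul s)
  rw [intervalIntegral.integral_const_mul] at this
  rw [expWeight, this]
  simp
  ring

lemma expWeight_nonneg (s : ℝ) : 0 ≤ expWeight s :=
  intervalIntegral.integral_nonneg zero_le_one fun _ _ => (Real.exp_pos _).le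

lemma expWeight_antitone : Antitone expWeight := by
  intro s t hst
  refine intervalIntegral.integral_mono_on zero_le_one (intervalIntegrable_exp_neg_mul _ _ _)
    (intervalIntegrable_exp_neg_mul _ _ _) fun z hz => Real.exp_le_exp.2 ?_
  nlinarith [mul_le_mul_of_nonneg_left hst hz.1]

lemma expWeight_le_one {s : ℝ} (hs : 0 ≤ s) : expWeight s ≤ 1 := by
  have h : expWeight 0 = 1 := by simp [expWeight]
  exact h ▸ expWeight_antitone hs

lemma half_le_expWeight {s : ℝ} (hs : s ≤ 1) : 1 / 2 ≤ expWeight s := by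
  have h : 1 - 1 / 2 ≤ expWeight 1 := by
    have h1 : (∫ z in (0:ℝ)..1, (1 - z)) = 1 - 1 / 2 := by
      rw [intervalIntegral.integral_sub (by simp) (by simp)]
      simp
    rw [← h1]
    refine intervalIntegral.integral_mono_on zero_le_one
      ((by fun_prop : Continuous fun z : ℝ => 1 - z).intervalIntegrable _ _)
      (intervalIntegrable_exp_neg_mul _ _ _) fun z _ => ?_
    linarith [Real.add_one_le_exp (-z * 1)]
  linarith [expWeight_antitone hs]

/-- Pointwise domination of `(1 - s)⁺` by a quadratic polynomial weighted by `expWeight`. -/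
lemma indicator_one_sub_le {m t : ℝ} (hm : m ≤ 1) (ht : 0 < t) (s : ℝ) :
    (Set.Icc (0:ℝ) 1).indicator (fun s => 1 - s) s ≤
      2 * (((t + (s - m) ^ 2 / t) / 4 + (m - s) / 2 + (1 - m)) * expWeight s) := by
  have hamgm : |m - s| ≤ (t + (s - m) ^ 2 / t) / 2 := by
    rw [show (t + (s - m) ^ 2 / t) / 2 = (t ^ 2 + (s - m) ^ 2) / (2 * t) by field_simp,
      le_div_iff₀ (by positivity)]
    nlinarith [sq_nonneg (t - |m - s|), sq_abs (m - s)]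
  have hpos := neg_abs_le (m - s)
  have hle := le_abs_self (m - s)
  by_cases hs : s ∈ Set.Icc (0:ℝ) 1
  · rw [Set.indicator_of_mem hs]
    have hw := half_le_expWeight hs.2
    nlinarith
  · rw [Set.indicator_of_notMem hs]
    have := expWeight_nonneg s
    have : 0 ≤ (t + (s - m) ^ 2 / t) / 4 + (m - s) / 2 + (1 - m) := by linarith
    positivity

lemma integrable_exp_neg_mul {ν : Measure ℝ} [IsFiniteMeasure ν] (h0 : ∀ᵐ s ∂ν, 0 ≤ s)
    {z : ℝ} (hz : 0 ≤ z) : Integrable (fun s => Real.exp (-z * s)) ν := by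
  refine Integrable.of_bound (by fun_prop) 1 ?_
  filter_upwards [h0] with s hs
  rw [Real.norm_eq_abs, abs_of_pos (Real.exp_pos _), Real.exp_le_one_iff]
  nlinarith [mul_nonneg hz hs]

lemma integrable_mul_exp_neg_mul {ν : Measure ℝ} (h0 : ∀ᵐ s ∂ν, 0 ≤ s)
    (hint : Integrable (fun s => s) ν) {z : ℝ} (hz : 0 ≤ z) :
    Integrable (fun s => s * Real.exp (-z * s)) ν := by
  refine hint.mono (by fun_prop) ?_
  filter_upwards [h0] with s hs
  rw [norm_mul]
  refine mul_le_of_le_one_right (norm_nonneg _) ?_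
  rw [Real.norm_eq_abs, abs_of_pos (Real.exp_pos _), Real.exp_le_one_iff]
  nlinarith [mul_nonneg hz hs]

/-- The Laplace transform integrated over `[0, 1]`. -/
lemma intervalIntegral_integral_exp_neg_mul {ν : Measure ℝ} [IsFiniteMeasure ν]
    (h0 : ∀ᵐ s ∂ν, 0 ≤ s) :
    (∫ z in (0:ℝ)..1, ∫ s, Real.exp (-z * s) ∂ν) = ∫ s, expWeight s ∂ν := by
  simp only [expWeight, intervalIntegral.integral_of_le zero_le_one]
  refine integral_integral_swap ?_
  refine Integrable.of_bound (by fun_prop) 1 ?_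
  have hz : ∀ᵐ z ∂(volume.restrict (Set.Ioc (0:ℝ) 1)), 0 < z := by
    filter_upwards [ae_restrict_mem measurableSet_Ioc] with z hz using hz.1
  filter_upwards [Measure.quasiMeasurePreserving_fst.ae hz,
    Measure.quasiMeasurePreserving_snd.ae h0] with p hp1 hp2
  simp only [Function.uncurry, Real.norm_eq_abs, abs_of_pos (Real.exp_pos _),
    Real.exp_le_one_iff]
  nlinarith [mul_nonneg hp1.le hp2]

/-- The Laplace transform of `s dν(s)` integrated over `[0, 1]`. -/
lemma intervalIntegral_integral_mul_exp_neg_mul {ν : Measure ℝ} [IsFiniteMeasure ν]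
    (h0 : ∀ᵐ s ∂ν, 0 ≤ s) (hint : Integrable (fun s => s) ν) :
    (∫ z in (0:ℝ)..1, ∫ s, s * Real.exp (-z * s) ∂ν) = ∫ s, s * expWeight s ∂ν := by
  simp only [expWeight, intervalIntegral.integral_of_le zero_le_one, ← integral_const_mul]
  refine integral_integral_swap ?_
  have hs : Integrable (fun p : ℝ × ℝ => p.2) ((volume.restrict (Set.Ioc (0:ℝ) 1)).prod ν) :=
    hint.comp_snd _
  refine hs.mono (by fun_prop) ?_
  have hz : ∀ᵐ z ∂(volume.restrict (Set.Ioc (0:ℝ) 1)), 0 < z := by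
    filter_upwards [ae_restrict_mem measurableSet_Ioc] with z hz using hz.1
  filter_upwards [Measure.quasiMeasurePreserving_fst.ae hz,
    Measure.quasiMeasurePreserving_snd.ae h0] with p hp1 hp2
  simp only [Function.uncurry, norm_mul]
  refine mul_le_of_le_one_right (norm_nonneg _) ?_
  rw [Real.norm_eq_abs, abs_of_pos (Real.exp_pos _), Real.exp_le_one_iff]
  nlinarith [mul_nonneg hp1.le hp2]

/-- Integral of a quadratic polynomial against the weight `w`. -/
lemma integral_quadratic_mul {α : Type*} [MeasurableSpace α] {ν : Measure α} {f w : α → ℝ}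
    (h0 : Integrable w ν) (h1 : Integrable (fun s => f s * w s) ν)
    (h2 : Integrable (fun s => f s ^ 2 * w s) ν) (p q r : ℝ) :
    Integrable (fun s => (p + q * f s + r * f s ^ 2) * w s) ν ∧
    (∫ s, (p + q * f s + r * f s ^ 2) * w s ∂ν) =
      p * (∫ s, w s ∂ν) + q * (∫ s, f s * w s ∂ν) + r * ∫ s, f s ^ 2 * w s ∂ν := by
  have e : (fun s => (p + q * f s + r * f s ^ 2) * w s) =
      fun s => p * w s + q * (f s * w s) + r * (f s ^ 2 * w s) := by
    ext s; ring
  have h01 : Integrable (fun s => p * w s + q * (f s * w s)) ν :=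
    (h0.const_mul p).add (h1.const_mul q)
  rw [e]
  refine ⟨h01.add (h2.const_mul r), ?_⟩
  rw [integral_add h01 (h2.const_mul r), integral_add (h0.const_mul p) (h1.const_mul q),
    integral_const_mul, integral_const_mul, integral_const_mul]

theorem stmt_7
    (ν : Measure ℝ) [IsProbabilityMeasure ν]
    (hsupp : ν (Set.Iio 0) = 0)
    (hint : Integrable (fun s => s) ν)
    (hmean : (∫ s, s ∂ν) = 1)
    (g : ℝ → ℝ) (hg : ∀ z : ℝ, g z = ∫ s, Real.exp (-z * s) ∂ν)
    (g' : ℝ → ℝ) (hg' : ∀ z : ℝ, g' z = -∫ s, s * Real.exp (-z * s) ∂ν) :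
    0 < 1 - g 1 ∧
    0 ≤ (1 + g' 1) * (∫ s in (0:ℝ)..1, g s) / (1 - g 1) ^ 2 - 1 ∧
    (∫ s in Set.Icc (0:ℝ) 1, (1 - s) ∂ν) ≤
      Real.sqrt ((1 + g' 1) * (∫ s in (0:ℝ)..1, g s) / (1 - g 1) ^ 2 - 1)
        + 2 * Real.exp 1 * ∫ s in (0:ℝ)..1, (g s + g' s) := by
  have h0 : ∀ᵐ s ∂ν, 0 ≤ s := by
    rw [ae_iff]
    simpa [Set.Iio] using hsupp
  have hmeas : AEStronglyMeasurable expWeight ν :=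
    expWeight_antitone.measurable.aestronglyMeasurable
  have hw0 : Integrable expWeight ν := by
    refine Integrable.of_bound hmeas 1 ?_
    filter_upwards [h0] with s hs
    rw [Real.norm_eq_abs, abs_of_nonneg (expWeight_nonneg s)]
    exact expWeight_le_one hs
  have hexp := integrable_exp_neg_mul h0 zero_le_one
  have hsexp := integrable_mul_exp_neg_mul h0 hint zero_le_one
  have e1 : (fun s => s * expWeight s) = fun s => 1 - Real.exp (-1 * s) := by
    ext s; rw [mul_expWeight, neg_one_mul]
  have e2 : (fun s => s ^ 2 * expWeight s) = fun s => s - s * Real.exp (-1 * s) := by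
    ext s; rw [sq, mul_assoc, mul_expWeight, neg_one_mul]; ring
  have hw1 : Integrable (fun s => s * expWeight s) ν := e1 ▸ (integrable_const 1).sub hexp
  have hw2 : Integrable (fun s => s ^ 2 * expWeight s) ν := e2 ▸ hint.sub hsexp
  have hb : 1 - g 1 = ∫ s, s * expWeight s ∂ν := by
    rw [e1, integral_sub (integrable_const 1) hexp, hg]; simp
  have hc : 1 + g' 1 = ∫ s, s ^ 2 * expWeight s ∂ν := by
    rw [e2, integral_sub hint hsexp, hg', hmean]; ring
  have ha : (∫ z in (0:ℝ)..1, g z) = ∫ s, expWeight s ∂ν := by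
    simp only [hg]; exact intervalIntegral_integral_exp_neg_mul h0
  have hanti : AntitoneOn g (Set.uIcc 0 1) := by
    intro x hx y hy hxy
    rw [Set.uIcc_of_le zero_le_one] at hx hy
    rw [hg, hg]
    refine integral_mono_ae (integrable_exp_neg_mul h0 hy.1) (integrable_exp_neg_mul h0 hx.1) ?_
    filter_upwards [h0] with s hs
    exact Real.exp_le_exp.2 (by nlinarith)
  have hmono : MonotoneOn g' (Set.uIcc 0 1) := by
    intro x hx y hy hxy
    rw [Set.uIcc_of_le zero_le_one] at hx hy
    rw [hg', hg']
    refine neg_le_neg (integral_mono_ae (integrable_mul_exp_neg_mul h0 hint hy.1)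
      (integrable_mul_exp_neg_mul h0 hint hx.1) ?_)
    filter_upwards [h0] with s hs
    exact mul_le_mul_of_nonneg_left (Real.exp_le_exp.2 (by nlinarith)) hs
  have hab : (∫ z in (0:ℝ)..1, (g z + g' z)) =
      (∫ s, expWeight s ∂ν) - ∫ s, s * expWeight s ∂ν := by
    rw [intervalIntegral.integral_add hanti.intervalIntegrable hmono.intervalIntegrable, ha,
      ← intervalIntegral_integral_mul_exp_neg_mul h0 hint]
    simp only [hg', intervalIntegral.integral_neg]
    ring
  have hquad := integral_quadratic_mul (f := fun s => s) hw0 hw1 hw2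
  rw [hab, ha, hb, hc]
  have hb_pos : 0 < ∫ s, s * expWeight s ∂ν := by
    have hnn : 0 ≤ᵐ[ν] fun s => s * expWeight s := by
      filter_upwards [h0] with s hs using mul_nonneg hs (expWeight_nonneg s)
    refine (integral_nonneg_of_ae hnn).lt_of_ne' fun h => ?_
    rw [integral_eq_zero_iff_of_nonneg_ae hnn hw1] at h
    have hz : (fun s : ℝ => s) =ᵐ[ν] fun _ => 0 := by
      filter_upwards [h] with s hs
      have : s * expWeight s = 0 := hs
      rw [mul_expWeight, sub_eq_zero, eq_comm, Real.exp_eq_one_iff] at this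
      linarith
    rw [integral_congr_ae hz] at hmean
    simp at hmean
  have hba : (∫ s, s * expWeight s ∂ν) ≤ ∫ s, expWeight s ∂ν := by
    have hcheb : (∫ s, (s * expWeight s - expWeight s) ∂ν) ≤ ∫ s, (s - 1) * expWeight 1 ∂ν := by
      refine integral_mono (hw1.sub hw0) ((hint.sub (integrable_const 1)).mul_const _) fun s => ?_
      rcases le_total s 1 with h | h
      · nlinarith [mul_nonneg (sub_nonneg.2 h) (sub_nonneg.2 (expWeight_antitone h))]
      · nlinarith [mul_nonneg (sub_nonneg.2 h) (sub_nonneg.2 (expWeight_antitone h))]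
    rw [integral_sub hw1 hw0, integral_mul_const, integral_sub hint (integrable_const 1),
      hmean] at hcheb
    simp at hcheb
    exact hcheb
  have ha_one : (∫ s, expWeight s ∂ν) ≤ 1 := by
    have : (∫ s, expWeight s ∂ν) ≤ ∫ _, (1:ℝ) ∂ν := by
      refine integral_mono_ae hw0 (integrable_const 1) ?_
      filter_upwards [h0] with s hs using expWeight_le_one hs
    simpa using this
  have hbound : ∀ m ≤ 1, ∀ t > 0, (∫ s in Set.Icc (0:ℝ) 1, (1 - s) ∂ν) ≤
      2 * ((t / 4 + m ^ 2 / t / 4 + m / 2 + (1 - m)) * (∫ s, expWeight s ∂ν) +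
        (-(m / t / 2) - 1 / 2) * (∫ s, s * expWeight s ∂ν) +
        1 / t / 4 * ∫ s, s ^ 2 * expWeight s ∂ν) := by
    intro m hm t ht
    obtain ⟨hi, he⟩ := hquad (t / 4 + m ^ 2 / t / 4 + m / 2 + (1 - m)) (-(m / t / 2) - 1 / 2)
      (1 / t / 4)
    rw [← he, ← integral_const_mul, ← integral_indicator measurableSet_Icc]
    refine integral_mono (((integrable_const 1).sub hint).indicator measurableSet_Icc)
      (hi.const_mul 2) fun s => (indicator_one_sub_le hm ht s).trans_eq ?_
    ring
  have hcs : 0 ≤ ∫ s, ((∫ s, s * expWeight s ∂ν) ^ 2 +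
      (-2 * (∫ s, s * expWeight s ∂ν) * ∫ s, expWeight s ∂ν) * s +
      (∫ s, expWeight s ∂ν) ^ 2 * s ^ 2) * expWeight s ∂ν := by
    refine integral_nonneg fun s => mul_nonneg ?_ (expWeight_nonneg s)
    nlinarith [sq_nonneg ((∫ s, s * expWeight s ∂ν) - (∫ s, expWeight s ∂ν) * s)]
  rw [(hquad _ _ _).2] at hcs
  generalize (∫ s, expWeight s ∂ν) = a at *
  generalize (∫ s, s * expWeight s ∂ν) = b at *
  generalize (∫ s, s ^ 2 * expWeight s ∂ν) = c at *
  have ha_pos : 0 < a := hb_pos.trans_le hba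
  have hdisc : b ^ 2 ≤ c * a := by
    have : 0 ≤ a * (c * a - b ^ 2) := by linarith
    linarith [nonneg_of_mul_nonneg_right this ha_pos]
  have hq : 0 ≤ c * a / b ^ 2 - 1 := by
    rw [sub_nonneg, one_le_div (by positivity)]
    exact hdisc
  refine ⟨hb_pos, hq, ?_⟩
  have hr := Real.sq_sqrt hq
  have hr0 := Real.sqrt_nonneg (c * a / b ^ 2 - 1)
  set r := √(c * a / b ^ 2 - 1)
  have hcr : c = (r ^ 2 + 1) * (b ^ 2 / a) := by
    rw [hr]; field_simp; ring
  have hb2a : b ^ 2 / a ≤ 1 := by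
    rw [div_le_one ha_pos]; nlinarith
  refine le_of_forall_pos_le_add fun ε hε => ?_
  have ht : 0 < r + ε := by positivity
  refine (hbound (b / a) ((div_le_one ha_pos).2 hba) (r + ε) ht).trans ?_
  have heq : 2 * (((r + ε) / 4 + (b / a) ^ 2 / (r + ε) / 4 + b / a / 2 + (1 - b / a)) * a +
      (-(b / a / (r + ε) / 2) - 1 / 2) * b + 1 / (r + ε) / 4 * c) =
      ((r + ε) * a + r ^ 2 / (r + ε) * (b ^ 2 / a)) / 2 + 2 * (a - b) := by
    rw [hcr]; field_simp; ring
  rw [heq]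
  have hra : (r + ε) * a ≤ r + ε := mul_le_of_le_one_right ht.le ha_one
  have hrr : r ^ 2 / (r + ε) ≤ r := by
    rw [div_le_iff₀ ht]; nlinarith [mul_nonneg hr0 hε.le]
  have hrb : r ^ 2 / (r + ε) * (b ^ 2 / a) ≤ r ^ 2 / (r + ε) :=
    mul_le_of_le_one_right (by positivity) hb2a
  have he : 2 * (a - b) ≤ 2 * Real.exp 1 * (a - b) := by
    nlinarith [mul_nonneg (sub_nonneg.2 hba) (sub_nonneg.2 (Real.one_le_exp zero_le_one))]
  linarith
end

section
/- Let ν be a Borel probability measure on [0,∞) with ∫₀^∞ s dν(s) = 1, g(z) = ∫₀^∞ e^{−zs} dν(s), g''(0) := ∫₀^∞ s² dν(s) < ∞, and assume ∫₁^∞ g(s)/s ds < ∞. Then for every α ∈ [0,1]: c_α[g] := (1/Γ(2−α)) ∫₀^∞ (g(z) − e^{−z}) z^{−1−α} dz = ∫₀^∞ G(s) s^{α−2} ds, where G(s) = ∫_{[0,s]} (s−τ) dν(τ) for 0 ≤ s ≤ 1 and G(s) = ∫_{[s,∞)} (τ−s) dν(τ) for s > 1. -/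
open MeasureTheory Real Set Filter

lemma lintegral_rpow_mul_exp_neg_mul_Ioi {a r : ℝ} (ha : 0 < a) (hr : 0 < r) :
    ∫⁻ t in Ioi (0:ℝ), ENNReal.ofReal (t ^ (a - 1) * exp (-(r * t)))
      = ENNReal.ofReal ((1 / r) ^ a * Gamma a) := by
  have h := integral_rpow_mul_exp_neg_mul_Ioi ha hr
  have hpos : 0 < (1 / r) ^ a * Gamma a :=
    mul_pos (rpow_pos_of_pos (by positivity) _) (Gamma_pos_of_pos ha)
  have hi : Integrable (fun t => t ^ (a - 1) * exp (-(r * t))) (volume.restrict (Ioi (0:ℝ))) := by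
    by_contra hc
    rw [integral_undef hc] at h
    exact hpos.ne h
  rw [← h, ofReal_integral_eq_lintegral_ofReal hi]
  filter_upwards [ae_restrict_mem measurableSet_Ioi] with t ht
  have ht' : (0:ℝ) < t := ht
  exact mul_nonneg (rpow_nonneg ht'.le _) (exp_pos _).le

lemma lintegral_posPart_sub_mul_exp_neg {τ z : ℝ} (hτ : 0 ≤ τ) (hz : 0 < z) :
    ∫⁻ s in Ioi (0:ℝ), ENNReal.ofReal (max (s - τ) 0 * exp (-(z * s)))
      = ENNReal.ofReal (exp (-z * τ) * (1 / z ^ 2)) := by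
  have h := lintegral_rpow_mul_exp_neg_mul_Ioi (a := 2) two_pos hz
  calc ∫⁻ s in Ioi (0:ℝ), ENNReal.ofReal (max (s - τ) 0 * exp (-(z * s)))
      = ∫⁻ s, (Ioi (0:ℝ)).indicator
          (fun u => ENNReal.ofReal (u * exp (-(z * (u + τ))))) (s - τ) := by
        rw [← lintegral_indicator measurableSet_Ioi]
        refine lintegral_congr fun s => ?_
        by_cases hs : 0 < s - τ
        · have hs0 : 0 < s := by linarith
          simp [indicator_of_mem, mem_Ioi, hs, hs0, hs.le, -sub_pos, -sub_nonneg]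
        · have hm : max (s - τ) 0 = 0 := max_eq_right (not_lt.mp hs)
          have : s - τ ∉ Ioi (0:ℝ) := hs
          rw [indicator_of_notMem this]
          simp only [indicator_apply, hm, zero_mul, ENNReal.ofReal_zero, ite_self]
    _ = ∫⁻ u in Ioi (0:ℝ), ENNReal.ofReal (u * exp (-(z * (u + τ)))) := by
        rw [lintegral_sub_right_eq_self, lintegral_indicator measurableSet_Ioi]
    _ = ∫⁻ u in Ioi (0:ℝ), ENNReal.ofReal (exp (-z * τ)) *
          ENNReal.ofReal (u ^ ((2:ℝ) - 1) * exp (-(z * u))) := by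
        refine lintegral_congr fun u => ?_
        rw [← ENNReal.ofReal_mul (exp_pos _).le]
        have e : exp (-(z * (u + τ))) = exp (-z * τ) * exp (-(z * u)) := by
          rw [← exp_add]; ring_nf
        have e2 : u ^ ((2:ℝ) - 1) = u := by norm_num
        rw [e, e2]; ring_nf
    _ = ENNReal.ofReal (exp (-z * τ) * (1 / z ^ 2)) := by
        rw [lintegral_const_mul _ (by fun_prop), h, ← ENNReal.ofReal_mul (exp_pos _).le]
        simp

lemma integrable_posPart_sub {ν : Measure ℝ} [IsProbabilityMeasure ν]
    (hint : Integrable (fun s => s) ν) (s : ℝ) :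
    Integrable (fun τ => max (s - τ) 0) ν :=
  ((integrable_const s).sub hint).sup (integrable_const 0)

lemma setIntegral_Icc_sub_eq_integral_posPart {ν : Measure ℝ}
    (hsupp : ν (Iio 0) = 0) (s : ℝ) :
    ∫ τ in Icc 0 s, (s - τ) ∂ν = ∫ τ, max (s - τ) 0 ∂ν := by
  rw [← integral_indicator measurableSet_Icc]
  refine integral_congr_ae ?_
  have hae : ∀ᵐ τ ∂ν, 0 ≤ τ := by simp only [ae_iff, not_le]; exact hsupp
  filter_upwards [hae] with τ hτ
  by_cases h : τ ≤ s
  · simp [hτ, h]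
  · simp [h, (not_le.mp h).le]

lemma setIntegral_Ici_sub_eq_integral_posPart {ν : Measure ℝ} [IsProbabilityMeasure ν]
    (hint : Integrable (fun s => s) ν)
    (hmean : (∫ s, s ∂ν) = 1) (s : ℝ) :
    ∫ τ in Ici s, (τ - s) ∂ν = (∫ τ, max (s - τ) 0 ∂ν) - (s - 1) := by
  have h1 : ∫ τ, (s - τ) ∂ν = s - 1 := by
    rw [integral_sub (integrable_const s) hint, hmean]; simp
  have h2 : Integrable (fun τ => s - τ) ν := (integrable_const s).sub hint
  rw [← h1, ← integral_sub (integrable_posPart_sub hint s) h2,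
    ← integral_indicator measurableSet_Ici]
  refine integral_congr_ae (ae_of_all _ fun τ => ?_)
  by_cases h : s ≤ τ
  · simp [h]
  · simp [h, (not_le.mp h).le]

lemma lintegral_integral_posPart_sub_mul_exp_neg {ν : Measure ℝ} [IsProbabilityMeasure ν]
    (hsupp : ν (Iio 0) = 0)
    (hint : Integrable (fun s => s) ν) {z : ℝ} (hz : 0 < z) :
    ∫⁻ s in Ioi (0:ℝ), ENNReal.ofReal ((∫ τ, max (s - τ) 0 ∂ν) * exp (-(z * s)))
      = ENNReal.ofReal ((∫ τ, exp (-z * τ) ∂ν) * (1 / z ^ 2)) := by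
  have hae : ∀ᵐ τ ∂ν, 0 ≤ τ := by simp only [ae_iff, not_le]; exact hsupp
  have hexp : Integrable (fun τ => exp (-z * τ)) ν := by
    refine Integrable.of_bound (by fun_prop) 1 ?_
    filter_upwards [hae] with τ hτ
    rw [norm_of_nonneg (exp_pos _).le, exp_le_one_iff]
    nlinarith
  calc ∫⁻ s in Ioi (0:ℝ), ENNReal.ofReal ((∫ τ, max (s - τ) 0 ∂ν) * exp (-(z * s)))
      = ∫⁻ s in Ioi (0:ℝ), ∫⁻ τ, ENNReal.ofReal (max (s - τ) 0 * exp (-(z * s))) ∂ν := by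
        refine lintegral_congr fun s => ?_
        rw [← integral_mul_const, ofReal_integral_eq_lintegral_ofReal
          ((integrable_posPart_sub hint s).mul_const _)
          (ae_of_all _ fun τ => by positivity)]
    _ = ∫⁻ τ, (∫⁻ s in Ioi (0:ℝ), ENNReal.ofReal (max (s - τ) 0 * exp (-(z * s)))) ∂ν :=
        lintegral_lintegral_swap (by fun_prop)
    _ = ∫⁻ τ, ENNReal.ofReal (exp (-z * τ) * (1 / z ^ 2)) ∂ν := by
        refine lintegral_congr_ae ?_
        filter_upwards [hae] with τ hτ
        exact lintegral_posPart_sub_mul_exp_neg hτ hz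
    _ = ENNReal.ofReal ((∫ τ, exp (-z * τ) ∂ν) * (1 / z ^ 2)) := by
        rw [← integral_mul_const, ofReal_integral_eq_lintegral_ofReal (hexp.mul_const _)
          (ae_of_all _ fun τ => by positivity)]

lemma measurable_integral_posPart_sub {ν : Measure ℝ} [IsProbabilityMeasure ν]
    (hint : Integrable (fun s => s) ν) :
    Measurable fun s => ∫ τ, max (s - τ) 0 ∂ν :=
  Monotone.measurable fun s t hst =>
    integral_mono (integrable_posPart_sub hint s) (integrable_posPart_sub hint t)
      fun τ => max_le_max (by simpa using hst) le_rfl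

lemma lintegral_lintegral_mul_exp_neg_mul_rpow {G : ℝ → ℝ} (hGm : Measurable G)
    (hG0 : ∀ s, 0 ≤ G s) {a : ℝ} (ha : 0 < a) :
    ∫⁻ z in Ioi (0:ℝ), (∫⁻ s in Ioi (0:ℝ), ENNReal.ofReal (G s * exp (-(z * s)))) *
        ENNReal.ofReal (z ^ (a - 1))
      = ENNReal.ofReal (Gamma a) * ∫⁻ s in Ioi (0:ℝ), ENNReal.ofReal (G s * s ^ (-a)) := by
  calc ∫⁻ z in Ioi (0:ℝ), (∫⁻ s in Ioi (0:ℝ), ENNReal.ofReal (G s * exp (-(z * s)))) *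
        ENNReal.ofReal (z ^ (a - 1))
      = ∫⁻ z in Ioi (0:ℝ), ∫⁻ s in Ioi (0:ℝ), ENNReal.ofReal (G s * exp (-(z * s))) *
          ENNReal.ofReal (z ^ (a - 1)) := by
        refine lintegral_congr fun z => ?_
        rw [lintegral_mul_const _ (by fun_prop)]
    _ = ∫⁻ s in Ioi (0:ℝ), ∫⁻ z in Ioi (0:ℝ), ENNReal.ofReal (G s * exp (-(z * s))) *
          ENNReal.ofReal (z ^ (a - 1)) :=
        lintegral_lintegral_swap (by fun_prop)
    _ = ∫⁻ s in Ioi (0:ℝ), ENNReal.ofReal (Gamma a) * ENNReal.ofReal (G s * s ^ (-a)) := by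
        refine setLIntegral_congr_fun measurableSet_Ioi fun s hs => ?_
        have hs' : (0:ℝ) < s := hs
        have e : ∀ z, ENNReal.ofReal (G s * exp (-(z * s))) * ENNReal.ofReal (z ^ (a - 1))
            = ENNReal.ofReal (G s) * ENNReal.ofReal (z ^ (a - 1) * exp (-(s * z))) := fun z => by
          rw [← ENNReal.ofReal_mul (mul_nonneg (hG0 s) (exp_pos _).le),
            ← ENNReal.ofReal_mul (hG0 s), mul_comm z s]
          ring_nf
        simp only [e]
        rw [lintegral_const_mul _ (by fun_prop), lintegral_rpow_mul_exp_neg_mul_Ioi ha hs',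
          ← ENNReal.ofReal_mul (hG0 s), ← ENNReal.ofReal_mul (Gamma_pos_of_pos ha).le,
          one_div, inv_rpow hs'.le, rpow_neg hs'.le]
        ring_nf
    _ = _ := lintegral_const_mul _ (by fun_prop)

theorem stmt_10
    (ν : Measure ℝ) [IsProbabilityMeasure ν]
    (hsupp : ν (Set.Iio 0) = 0)
    (hint : Integrable (fun s => s) ν)
    (hmean : (∫ s, s ∂ν) = 1)
    (hm2 : Integrable (fun s => s ^ 2) ν)
    (g : ℝ → ℝ) (hg : ∀ z : ℝ, g z = ∫ s, Real.exp (-z * s) ∂ν)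
    (hgtail : IntegrableOn (fun s => g s / s) (Set.Ioi 1))
    (G : ℝ → ℝ)
    (hG : ∀ s : ℝ, G s = if s ≤ 1 then ∫ τ in Set.Icc 0 s, (s - τ) ∂ν
        else ∫ τ in Set.Ici s, (τ - s) ∂ν) :
    ∀ α ∈ Set.Icc (0:ℝ) 1,
      (1 / Real.Gamma (2 - α)) *
          (∫ z in Set.Ioi (0:ℝ), (g z - Real.exp (-z)) * z ^ (-1 - α))
        = ∫ s in Set.Ioi (0:ℝ), G s * s ^ (α - 2) := by
  intro α hα
  have hΓ : 0 < Gamma (2 - α) := Gamma_pos_of_pos (by linarith [hα.2])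
  have hG0 : ∀ s, 0 ≤ G s := fun s => by
    rw [hG]
    split_ifs
    · exact setIntegral_nonneg measurableSet_Icc fun τ hτ => sub_nonneg.mpr hτ.2
    · exact setIntegral_nonneg measurableSet_Ici fun τ hτ => sub_nonneg.mpr hτ
  have hGF : ∀ s, G s + max (s - 1) 0 = ∫ τ, max (s - τ) 0 ∂ν := fun s => by
    rw [hG]
    split_ifs with h
    · rw [setIntegral_Icc_sub_eq_integral_posPart hsupp, max_eq_right (by linarith), add_zero]
    · rw [setIntegral_Ici_sub_eq_integral_posPart hint hmean, max_eq_left (by linarith)]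
      ring
  have hGm : Measurable G := by
    have : G = fun s => (∫ τ, max (s - τ) 0 ∂ν) - max (s - 1) 0 := by
      ext s; linarith [hGF s]
    rw [this]
    exact (measurable_integral_posPart_sub hint).sub (by fun_prop)
  have hgm : Measurable g := by
    have : g = fun z => ∫ s, exp (-z * s) ∂ν := funext hg
    rw [this]
    have hc : StronglyMeasurable (fun p : ℝ × ℝ => exp (-p.1 * p.2)) :=
      Continuous.stronglyMeasurable (by fun_prop)
    exact hc.integral_prod_right.measurable
  have hadd : ∀ z : ℝ, 0 < z →
      (∫⁻ s in Ioi (0:ℝ), ENNReal.ofReal (G s * exp (-(z * s)))) +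
        ENNReal.ofReal (exp (-z) * (1 / z ^ 2)) = ENNReal.ofReal (g z * (1 / z ^ 2)) := by
    intro z hz
    have h1 := lintegral_posPart_sub_mul_exp_neg zero_le_one hz
    rw [mul_one] at h1
    rw [← h1, ← lintegral_add_left (by fun_prop), hg,
      ← lintegral_integral_posPart_sub_mul_exp_neg hsupp hint hz]
    refine lintegral_congr fun s => ?_
    rw [← ENNReal.ofReal_add (mul_nonneg (hG0 s) (exp_pos _).le) (by positivity), ← add_mul, hGF]
  have hlap : ∀ z : ℝ, 0 < z →
      ∫⁻ s in Ioi (0:ℝ), ENNReal.ofReal (G s * exp (-(z * s)))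
        = ENNReal.ofReal ((g z - exp (-z)) * (1 / z ^ 2)) := by
    intro z hz
    rw [sub_mul, ENNReal.ofReal_sub _ (by positivity)]
    exact ENNReal.eq_sub_of_add_eq ENNReal.ofReal_ne_top (hadd z hz)
  have hge : ∀ z : ℝ, 0 < z → 0 ≤ g z - exp (-z) := by
    intro z hz
    have h0 : 0 ≤ g z := by rw [hg]; exact integral_nonneg fun _ => (exp_pos _).le
    have h := (hadd z hz) ▸ (le_add_self : ENNReal.ofReal (exp (-z) * (1 / z ^ 2)) ≤
      (∫⁻ s in Ioi (0:ℝ), ENNReal.ofReal (G s * exp (-(z * s)))) + _)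
    rw [ENNReal.ofReal_le_ofReal_iff (by positivity)] at h
    exact sub_nonneg.mpr (le_of_mul_le_mul_right h (by positivity))
  have hkey : ∫⁻ z in Ioi (0:ℝ), ENNReal.ofReal ((g z - exp (-z)) * z ^ (-1 - α))
      = ENNReal.ofReal (Gamma (2 - α)) *
        ∫⁻ s in Ioi (0:ℝ), ENNReal.ofReal (G s * s ^ (α - 2)) := by
    have h := lintegral_lintegral_mul_exp_neg_mul_rpow hGm hG0 (a := 2 - α) (by linarith [hα.2])
    rw [neg_sub] at h
    rw [← h]
    refine setLIntegral_congr_fun measurableSet_Ioi fun z hz => ?_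
    have hz' : (0:ℝ) < z := hz
    have e : z ^ (-1 - α) = 1 / z ^ 2 * z ^ (2 - α - 1) := by
      rw [show -1 - α = (2 - α - 1) - (2:ℕ) by push_cast; ring, rpow_sub_natCast hz'.ne']
      ring
    rw [hlap z hz', ← ENNReal.ofReal_mul (mul_nonneg (hge z hz') (by positivity)), e, mul_assoc]
  rw [integral_eq_lintegral_of_nonneg_ae, integral_eq_lintegral_of_nonneg_ae, hkey,
    ENNReal.toReal_mul, ENNReal.toReal_ofReal hΓ.le, ← mul_assoc, one_div_mul_cancel hΓ.ne',
    one_mul]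
  · filter_upwards [ae_restrict_mem measurableSet_Ioi] with s hs
    have hs' : (0:ℝ) < s := hs
    exact mul_nonneg (hG0 s) (rpow_nonneg hs'.le _)
  · exact (by fun_prop : Measurable fun s => G s * s ^ (α - 2)).aestronglyMeasurable
  · filter_upwards [ae_restrict_mem measurableSet_Ioi] with z hz
    have hz' : (0:ℝ) < z := hz
    exact mul_nonneg (hge z hz') (rpow_nonneg hz'.le _)
  · exact (by fun_prop :
      Measurable fun z => (g z - exp (-z)) * z ^ (-1 - α)).aestronglyMeasurable
end
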